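/- There exist universal constants c1, c2 > 0 such that the following holds. Let G = (V, E, w) be a weighted graph with doubling dimension ddim ≥ 1 and let t ≥ 2 be a parameter. Then G admits a (c1 · t, c2 · 2^{ddim/t} · ddim · log t)-sparse cover scheme: for every Δ > 0 there is a collection of clusters, each of strong diameter at most Δ, such that for every v ∈ V some cluster contains the ball B_G(v, Δ/(c1·t)), and every vertex belongs to at most c2 · 2^{ddim/t} · ddim · log t clusters. -/

import Mathlib

open MeasureTheory

namespace Pad

variable {V : Type*}

/-- The weight of a walk: the sum of the weights of its edges. -/
def walkWeight (w : Sym2 V → ℝ) {G : SimpleGraph V} {u v : V} (p : G.Walk u v) : ℝ :=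
  (p.darts.map fun d => w d.edge).sum

/-- Shortest-path distance in the weighted graph `(G, w)`. -/
noncomputable def wdist (w : Sym2 V → ℝ) (G : SimpleGraph V) (u v : V) : ℝ :=
  sInf {x | ∃ p : G.Walk u v, x = walkWeight w p}

/-- Distance from a vertex to a set of vertices. -/
noncomputable def wdistSet (w : Sym2 V → ℝ) (G : SimpleGraph V) (v : V) (A : Set V) : ℝ :=
  sInf {x | ∃ a ∈ A, x = wdist w G v a}

/-- The closed ball of radius `r` around `v`. -/
def ball (w : Sym2 V → ℝ) (G : SimpleGraph V) (v : V) (r : ℝ) : Set V :=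
  {u | wdist w G v u ≤ r}

/-- Weight of a walk of an induced subgraph, measured with the weights of `G`. -/
def walkWeightI (w : Sym2 V → ℝ) {G : SimpleGraph V} {C : Set V} {u v : C}
    (p : (G.induce C).Walk u v) : ℝ :=
  (p.darts.map fun d => w (Sym2.map Subtype.val d.edge)).sum

/-- The cluster `C` has strong diameter at most `Δ`: every two vertices of `C` are joined,
inside the induced subgraph `G[C]`, by a walk of weight at most `Δ`. -/
def StronglyBounded (w : Sym2 V → ℝ) (G : SimpleGraph V) (C : Set V) (Δ : ℝ) : Prop :=
  ∀ u v : C, ∃ p : (G.induce C).Walk u v, walkWeightI w p ≤ Δ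

/-- A partition of `V`, given by the map `cl` sending a vertex to its cluster. -/
structure Partition (V : Type*) where
  cl : V → Set V
  mem_cl : ∀ v, v ∈ cl v
  cl_eq : ∀ u v, u ∈ cl v → cl u = cl v

/-- A partition is strongly `Δ`-bounded if each of its clusters has strong diameter at most `Δ`. -/
def Partition.StronglyBounded (w : Sym2 V → ℝ) (G : SimpleGraph V) (P : Partition V)
    (Δ : ℝ) : Prop :=
  ∀ v : V, Pad.StronglyBounded w G (P.cl v) Δ

/-- `(G, w)` has doubling dimension `ddim`: every ball of radius `2r` can be covered by
`2 ^ ddim` balls of radius `r`. -/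
def Doubling (w : Sym2 V → ℝ) (G : SimpleGraph V) (ddim : ℝ) : Prop :=
  ∀ (x : V) (r : ℝ), 0 < r → ∃ T : Set V, T.Finite ∧ ((T.ncard : ℝ) ≤ (2 : ℝ) ^ ddim) ∧
    ball w G x (2 * r) ⊆ ⋃ y ∈ T, ball w G y r

/-- `G` has the complete graph `K_r` as a minor: there are `r` pairwise disjoint connected
branch sets with an edge of `G` between any two of them. -/
def HasCliqueMinor (G : SimpleGraph V) (r : ℕ) : Prop :=
  ∃ B : Fin r → Set V,
    (∀ i, (G.induce (B i)).Connected) ∧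
    (Pairwise fun i j => Disjoint (B i) (B j)) ∧
    ∀ i j : Fin r, i ≠ j → ∃ u ∈ B i, ∃ v ∈ B j, G.Adj u v

/-- A shortest path: a path whose weight equals the distance between its endpoints. -/
def IsShortestPath (w : Sym2 V → ℝ) (G : SimpleGraph V) {u v : V} (p : G.Walk u v) : Prop :=
  p.IsPath ∧ walkWeight w p = wdist w G u v

/-- `G` has an `r`-core with radius `Δ`: there are at most `r` shortest paths such that every
vertex is within distance `Δ` of their union. -/
def HasCore (w : Sym2 V → ℝ) (G : SimpleGraph V) (r : ℕ) (Δ : ℝ) : Prop :=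
  ∃ r' : ℕ, r' ≤ r ∧ ∃ (a b : Fin r' → V) (p : ∀ i, G.Walk (a i) (b i)),
    (∀ i, IsShortestPath w G (p i)) ∧
    ∀ v : V, ∃ i, ∃ u ∈ (p i).support, wdist w G v u ≤ Δ

end Pad

section Probability

open ProbabilityTheory

/-- The symmetric Lovász local lemma. -/
theorem lovasz_local_lemma {Ω ι : Type*} [MeasurableSpace Ω] [DecidableEq ι]
    (P : Measure Ω) [IsProbabilityMeasure P] (A : ι → Set Ω) (hA : ∀ i, MeasurableSet (A i))
    (Γ : ι → Finset ι) {p D : ℝ} (hp : ∀ i, P.real (A i) ≤ p)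
    (hΓ : ∀ i, ((Γ i).card : ℝ) ≤ D) (hD : 1 ≤ D) (hpD : 4 * p * D ≤ 1)
    (hind : ∀ i (S : Finset ι), Disjoint S (Γ i) →
      P.real (A i ∩ ⋂ j ∈ S, (A j)ᶜ) = P.real (A i) * P.real (⋂ j ∈ S, (A j)ᶜ))
    (S : Finset ι) : 0 < P.real (⋂ j ∈ S, (A j)ᶜ) := by
  have hmeas : ∀ S : Finset ι, MeasurableSet (⋂ j ∈ S, (A j)ᶜ) := fun S =>
    S.measurableSet_biInter fun j _ => (hA j).compl
  have key : ∀ n : ℕ, ∀ S : Finset ι, S.card = n → ∀ i,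
      P.real (A i ∩ ⋂ j ∈ S, (A j)ᶜ) ≤ 2 * p * P.real (⋂ j ∈ S, (A j)ᶜ) := by
    intro n
    induction n using Nat.strong_induction_on with
    | _ n ih =>
      intro S hS i
      have hp0 : 0 ≤ p := measureReal_nonneg.trans (hp i)
      have hind' := hind i (S \ Γ i) Finset.sdiff_disjoint
      have hfar : P.real (A i ∩ ⋂ j ∈ S \ Γ i, (A j)ᶜ) ≤ p * P.real (⋂ j ∈ S \ Γ i, (A j)ᶜ) := by
        rw [hind']
        exact mul_le_mul_of_nonneg_right (hp i) measureReal_nonneg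
      by_cases hne : (S ∩ Γ i) = ∅
      · have hSeq : S \ Γ i = S := by
          rw [Finset.sdiff_eq_self_iff_disjoint, Finset.disjoint_iff_inter_eq_empty, hne]
        rw [hSeq] at hfar
        nlinarith [measureReal_nonneg (μ := P) (s := ⋂ j ∈ S, (A j)ᶜ)]
      · have hcard : (S \ Γ i).card < n := by
          have h1 := Finset.card_sdiff_add_card_inter S (Γ i)
          have h2 := Finset.card_pos.2 (Finset.nonempty_iff_ne_empty.2 hne)
          omega
        have hmono : P.real (A i ∩ ⋂ j ∈ S, (A j)ᶜ) ≤ P.real (A i ∩ ⋂ j ∈ S \ Γ i, (A j)ᶜ) := by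
          refine measureReal_mono (Set.inter_subset_inter_right _ ?_)
          exact Set.biInter_subset_biInter_left fun j hj => Finset.sdiff_subset hj
        have hsub : (⋂ j ∈ S \ Γ i, (A j)ᶜ) ⊆ (⋂ j ∈ S, (A j)ᶜ) ∪
            ⋃ j ∈ S ∩ Γ i, (A j ∩ ⋂ k ∈ S \ Γ i, (A k)ᶜ) := by
          intro ω hω
          by_cases h : ω ∈ ⋂ j ∈ S, (A j)ᶜ
          · exact Or.inl h
          · right
            simp only [Set.mem_iInter, not_forall, Set.mem_compl_iff, not_not] at h
            obtain ⟨j, hj, hωj⟩ := h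
            have hjΓ : j ∈ Γ i := by
              by_contra hjΓ
              exact (Set.mem_iInter₂.1 hω j (Finset.mem_sdiff.2 ⟨hj, hjΓ⟩)) hωj
            exact Set.mem_biUnion (Finset.mem_coe.2 (Finset.mem_inter.2 ⟨hj, hjΓ⟩)) ⟨hωj, hω⟩
        have hsum : P.real (⋂ j ∈ S \ Γ i, (A j)ᶜ) ≤ P.real (⋂ j ∈ S, (A j)ᶜ) +
            ∑ j ∈ S ∩ Γ i, P.real (A j ∩ ⋂ k ∈ S \ Γ i, (A k)ᶜ) :=
          (measureReal_mono hsub).trans <| (measureReal_union_le _ _).trans <|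
            add_le_add_right (measureReal_biUnion_finset_le _ _) _
        have hbound : ∑ j ∈ S ∩ Γ i, P.real (A j ∩ ⋂ k ∈ S \ Γ i, (A k)ᶜ) ≤
            1 / 2 * P.real (⋂ j ∈ S \ Γ i, (A j)ᶜ) := by
          refine (Finset.sum_le_card_nsmul _ _ _ fun j _ => ih _ hcard _ rfl j).trans ?_
          rw [nsmul_eq_mul]
          have h1 : ((S ∩ Γ i).card : ℝ) ≤ D :=
            (Nat.cast_le.2 (Finset.card_le_card Finset.inter_subset_right)).trans (hΓ i)
          have h2 : ((S ∩ Γ i).card : ℝ) * (2 * p) ≤ 1 / 2 := by nlinarith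
          rw [← mul_assoc]
          exact mul_le_mul_of_nonneg_right h2 measureReal_nonneg
        nlinarith [measureReal_nonneg (μ := P) (s := ⋂ j ∈ S, (A j)ᶜ)]
  induction S using Finset.induction_on with
  | empty => simp
  | insert i S hi ih =>
    have hp0 : 0 ≤ p := measureReal_nonneg.trans (hp i)
    have h1 := key _ S rfl i
    have h2 := measureReal_inter_add_sdiff (μ := P) (s := ⋂ j ∈ S, (A j)ᶜ) (hA i)
    rw [Finset.set_biInter_insert, Set.inter_comm, ← Set.sdiff_eq]
    rw [Set.inter_comm] at h2
    nlinarith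

/-- Under a product measure, events that depend on disjoint sets of coordinates are
independent. -/
theorem measureReal_pi_inter_of_dependsOn {V E : Type*} [Fintype V] [Finite E]
    [MeasurableSpace E] [DiscreteMeasurableSpace E] (μ : Measure E) [IsProbabilityMeasure μ]
    {A B : Set (V → E)} {S T : Finset V} (hST : Disjoint S T)
    (hA : DependsOn (· ∈ A) S) (hB : DependsOn (· ∈ B) T) :
    (Measure.pi fun _ : V => μ).real (A ∩ B) =
      (Measure.pi fun _ : V => μ).real A * (Measure.pi fun _ : V => μ).real B := by
  have hpre : ∀ (C : Set (V → E)) (U : Finset V), DependsOn (· ∈ C) U →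
      C = (fun (ω : V → E) (i : U) => ω i) ⁻¹' ((fun (ω : V → E) (i : U) => ω i) '' C) := by
    intro C U hC
    refine (Set.subset_preimage_image _ _).antisymm ?_
    rintro ω ⟨ω', hω', h⟩
    have := hC (x := ω') (y := ω) fun i hi => congrFun h ⟨i, hi⟩
    exact this.mp hω'
  have hindep : IndepFun (fun (ω : V → E) (i : S) => ω i) (fun (ω : V → E) (i : T) => ω i)
      (Measure.pi fun _ : V => μ) :=
    (iIndepFun_pi (μ := fun _ : V => μ) (X := fun _ => id)
      fun _ => measurable_id.aemeasurable).indepFun_finset S T hST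
      fun i => measurable_pi_apply i
  have := hindep.measure_inter_preimage_eq_mul _ _
    (Set.toFinite ((fun (ω : V → E) (i : S) => ω i) '' A)).measurableSet
    (Set.toFinite ((fun (ω : V → E) (i : T) => ω i) '' B)).measurableSet
  rw [← hpre A S hA, ← hpre B T hB] at this
  simp [measureReal_def, this, ENNReal.toReal_mul]

/-- The geometric distribution truncated at `M`. -/
theorem exists_truncated_geometric {θ : ℝ} (h0 : 0 < θ) (h1 : θ < 1) (M : ℕ) :
    ∃ μ : Measure (Fin (M + 1)), IsProbabilityMeasure μ ∧
      ∀ j : ℕ, j ≤ M → μ.real {g | j ≤ (g : ℕ)} = θ ^ j := by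
  have hlog : 0 < -Real.log θ := by
    have := Real.log_neg h0 h1
    linarith
  have := isProbabilityMeasure_expMeasure hlog
  let f : ℝ → Fin (M + 1) := fun x => ⟨min ⌊x⌋₊ M, by omega⟩
  have hf : Measurable f :=
    (measurable_of_countable (fun n : ℕ => (⟨min n M, by omega⟩ : Fin (M + 1)))).comp
      Nat.measurable_floor
  refine ⟨(expMeasure (-Real.log θ)).map f, Measure.isProbabilityMeasure_map hf.aemeasurable, ?_⟩
  intro j hj
  rw [map_measureReal_apply hf (Set.toFinite _).measurableSet]
  rcases Nat.eq_zero_or_pos j with rfl | hj0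
  · simp
  · have hset : f ⁻¹' {g | j ≤ (g : ℕ)} = (Set.Iio (j : ℝ))ᶜ := by
      ext x
      simp [f, hj, Nat.le_floor_iff' hj0.ne']
    have hIio : (expMeasure (-Real.log θ)).real (Set.Iio (j : ℝ)) =
        (expMeasure (-Real.log θ)).real (Set.Iic (j : ℝ)) := by
      exact measureReal_congr ((withDensity_absolutelyContinuous volume _).ae_eq Iio_ae_eq_Iic)
    rw [hset, probReal_compl_eq_one_sub measurableSet_Iio, hIio, ← cdf_eq_real,
      cdf_expMeasure_eq hlog, if_pos (Nat.cast_nonneg j)]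
    rw [sub_sub_cancel, neg_mul, neg_neg, mul_comm, Real.exp_nat_mul, Real.exp_log h0]

end Probability

section Tail

variable {M : ℕ} {μ : Measure (Fin (M + 1))} {θ : ℝ}

theorem measureReal_int_tail (hμ : ∀ j : ℕ, j ≤ M → μ.real {g | j ≤ (g : ℕ)} = θ ^ j)
    {j : ℤ} (hj : j ≤ M) : μ.real {g | j ≤ (g : ℕ)} = θ ^ j.toNat := by
  rw [← hμ j.toNat (by omega)]
  congr 1
  ext g
  simp

/-- The factor attached to one coordinate when estimating the probability that many shifted
values lie close to a common upper bound `T`. -/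
noncomputable def windowWeight (z : ℝ) (T : ℤ) (k g : ℕ) : ℝ :=
  if T < (g : ℤ) - k then 0 else if T - 4 ≤ (g : ℤ) - k then z else 1

theorem windowWeight_nonneg {z : ℝ} (hz : 0 ≤ z) (T : ℤ) (k g : ℕ) :
    0 ≤ windowWeight z T k g := by
  unfold windowWeight
  split_ifs <;> linarith

theorem integral_windowWeight_le [IsProbabilityMeasure μ]
    (hμ : ∀ j : ℕ, j ≤ M → μ.real {g | j ≤ (g : ℕ)} = θ ^ j)
    (h0 : 0 < θ) (h1 : θ < 1) (hM : 4 ≤ M) {z : ℝ} (hz1 : 1 ≤ z) (hz2 : z ≤ 2)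
    (hz : z * (1 - θ ^ 5) ≤ 1) (T : ℤ) (k : ℕ) :
    ∫ g, windowWeight z T k (g : ℕ) ∂μ ≤ 1 + θ ^ (M - 4) := by
  have hfun : (fun g : Fin (M + 1) => windowWeight z T k (g : ℕ)) = fun g =>
      1 + (z - 1) * ({g | T - 4 + k ≤ ((g : ℕ) : ℤ)} : Set (Fin (M + 1))).indicator 1 g -
        z * ({g | T - 4 + k + 5 ≤ ((g : ℕ) : ℤ)} : Set (Fin (M + 1))).indicator 1 g := by
    funext g
    simp only [windowWeight, Set.indicator, Set.mem_ofPred_eq, Pi.one_apply]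
    split_ifs <;> first | omega | ring
  have hint : ∫ g, windowWeight z T k (g : ℕ) ∂μ =
      1 + (z - 1) * μ.real {g | T - 4 + k ≤ ((g : ℕ) : ℤ)} -
        z * μ.real {g | T - 4 + k + 5 ≤ ((g : ℕ) : ℤ)} := by
    rw [hfun, integral_sub .of_finite .of_finite, integral_add .of_finite .of_finite,
      integral_const_mul, integral_const_mul, integral_indicator_one (Set.toFinite _).measurableSet,
      integral_indicator_one (Set.toFinite _).measurableSet]
    simp
  rw [hint]
  have hθM : 0 < θ ^ (M - 4) := pow_pos h0 _
  by_cases hcase : T - 4 + k + 5 ≤ M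
  · rw [measureReal_int_tail hμ hcase, measureReal_int_tail hμ (by omega)]
    have hpow : θ ^ (T - 4 + k).toNat * θ ^ 5 ≤ θ ^ (T - 4 + k + 5).toNat := by
      rw [← pow_add]
      exact pow_le_pow_of_le_one h0.le h1.le (by omega)
    have hnn : 0 ≤ θ ^ (T - 4 + k).toNat := pow_nonneg h0.le _
    nlinarith [mul_le_mul_of_nonneg_left hz hnn]
  · have hle : μ.real {g | T - 4 + k ≤ ((g : ℕ) : ℤ)} ≤ θ ^ (M - 4) := by
      rw [← hμ (M - 4) (by omega)]
      refine measureReal_mono fun g hg => ?_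
      simp only [Set.mem_ofPred_eq] at hg ⊢
      omega
    have h2 : 0 ≤ μ.real {g | T - 4 + k + 5 ≤ ((g : ℕ) : ℤ)} := measureReal_nonneg
    have h3 : 0 ≤ μ.real {g | T - 4 + k ≤ ((g : ℕ) : ℤ)} := measureReal_nonneg
    nlinarith

/-- All shifted values over `L` are at most `T`, and at least `n` of them are at least `T - 4`. -/
def crowded {V : Type*} (M : ℕ) (L : Finset V) (k : V → ℕ) (T : ℤ) (n : ℕ) :
    Set (V → Fin (M + 1)) :=
  {ω | (∀ c ∈ L, ((ω c : ℕ) : ℤ) - k c ≤ T) ∧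
    n ≤ (L.filter fun c => T - 4 ≤ ((ω c : ℕ) : ℤ) - k c).card}

theorem dependsOn_crowded {V : Type*} (M : ℕ) (L : Finset V) (k : V → ℕ) (T : ℤ) (n : ℕ) :
    DependsOn (· ∈ crowded M L k T n) L := by
  intro ω ω' h
  have hfilter : (L.filter fun c => T - 4 ≤ ((ω c : ℕ) : ℤ) - k c) =
      L.filter fun c => T - 4 ≤ ((ω' c : ℕ) : ℤ) - k c :=
    Finset.filter_congr fun c hc => by rw [h c hc]
  have hall : (∀ c ∈ L, ((ω c : ℕ) : ℤ) - k c ≤ T) ↔ ∀ c ∈ L, ((ω' c : ℕ) : ℤ) - k c ≤ T :=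
    forall₂_congr fun c hc => by rw [h c hc]
  simp only [crowded, Set.mem_ofPred_eq, hfilter, hall]

theorem measureReal_crowded_le [IsProbabilityMeasure μ] {V : Type*} [Fintype V]
    (hμ : ∀ j : ℕ, j ≤ M → μ.real {g | j ≤ (g : ℕ)} = θ ^ j)
    (h0 : 0 < θ) (h1 : θ < 1) (hM : 4 ≤ M) (L : Finset V) (k : V → ℕ) (T : ℤ) (n : ℕ) :
    (Measure.pi fun _ : V => μ).real (crowded M L k T n) ≤
      (1 - θ ^ 5 / 2) ^ n * (1 + θ ^ (M - 4)) ^ L.card := by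
  classical
  have hθ5 : 0 < θ ^ 5 := pow_pos h0 _
  have hθ5' : θ ^ 5 < 1 := pow_lt_one₀ h0.le h1 (by norm_num)
  set y : ℝ := 1 - θ ^ 5 / 2 with hy
  have hy0 : 0 < y := by linarith
  set z : ℝ := y⁻¹ with hz
  have hyz : y * z = 1 := mul_inv_cancel₀ hy0.ne'
  have hz1 : 1 ≤ z := by nlinarith
  have hz2 : z ≤ 2 := by nlinarith
  have hz3 : z * (1 - θ ^ 5) ≤ 1 := by nlinarith
  let f : V → Fin (M + 1) → ℝ := fun c g => if c ∈ L then windowWeight z T (k c) g else 1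
  have hf0 : ∀ c g, 0 ≤ f c g := by
    intro c g
    simp only [f]
    split_ifs
    · exact windowWeight_nonneg (by linarith) _ _ _
    · exact zero_le_one
  have hprod : ∫ ω : V → Fin (M + 1), ∏ c, f c (ω c) ∂(Measure.pi fun _ : V => μ) ≤
      (1 + θ ^ (M - 4)) ^ L.card := by
    rw [integral_fintype_prod_eq_prod (𝕜 := ℝ) (E := fun _ : V => Fin (M + 1)) f]
    calc ∏ c, ∫ g, f c g ∂μ ≤ ∏ c : V, if c ∈ L then (1 + θ ^ (M - 4)) else 1 := by
          refine Finset.prod_le_prod (fun c _ => integral_nonneg (hf0 c)) fun c _ => ?_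
          by_cases hc : c ∈ L
          · simpa only [f, hc, if_true] using
              integral_windowWeight_le hμ h0 h1 hM hz1 hz2 hz3 T (k c)
          · simp [f, hc]
      _ = _ := by simp [Finset.prod_ite_mem]
  have hpoint : ∀ ω ∈ crowded M L k T n, z ^ n ≤ ∏ c, f c (ω c) := by
    rintro ω ⟨hle, hn⟩
    calc z ^ n ≤ z ^ (L.filter fun c => T - 4 ≤ ((ω c : ℕ) : ℤ) - k c).card :=
          pow_le_pow_right₀ hz1 hn
      _ = ∏ c ∈ L, if T - 4 ≤ ((ω c : ℕ) : ℤ) - k c then z else 1 := by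
          rw [Finset.prod_ite]; simp
      _ = ∏ c ∈ L, windowWeight z T (k c) (ω c) := by
          refine Finset.prod_congr rfl fun c hc => ?_
          rw [windowWeight, if_neg (not_lt.2 (hle c hc))]
      _ = ∏ c, f c (ω c) := by simp [f, Finset.prod_ite_mem]
  have hind : z ^ n * (Measure.pi fun _ : V => μ).real (crowded M L k T n) ≤
      ∫ ω : V → Fin (M + 1), ∏ c, f c (ω c) ∂(Measure.pi fun _ : V => μ) := by
    rw [← integral_indicator_one (Set.toFinite _).measurableSet, ← integral_const_mul]
    refine integral_mono .of_finite .of_finite fun ω => ?_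
    by_cases hω : ω ∈ crowded M L k T n
    · simpa [hω] using hpoint ω hω
    · simpa [hω] using Finset.prod_nonneg fun c _ => hf0 c (ω c)
  calc (Measure.pi fun _ : V => μ).real (crowded M L k T n)
      = y ^ n * (z ^ n * (Measure.pi fun _ : V => μ).real (crowded M L k T n)) := by
        rw [← mul_assoc, ← mul_pow, hyz, one_pow, one_mul]
    _ ≤ _ := mul_le_mul_of_nonneg_left (hind.trans hprod) (pow_nonneg hy0.le n)

end Tail

section Nets

variable {V : Type*} [PseudoMetricSpace V] {ddim : ℝ}

/-- Every ball of radius `2 * r` is covered by at most `2 ^ ddim` balls of radius `r`. -/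
def IsDoubling (V : Type*) [PseudoMetricSpace V] (ddim : ℝ) : Prop :=
  ∀ (x : V) (r : ℝ), 0 < r → ∃ T : Finset V, ((T.card : ℝ) ≤ (2 : ℝ) ^ ddim) ∧
    ∀ u, dist x u ≤ 2 * r → ∃ y ∈ T, dist y u ≤ r

theorem IsDoubling.exists_cover (h : IsDoubling V ddim) (j : ℕ) (x : V) {r : ℝ} (hr : 0 < r) :
    ∃ T : Finset V, ((T.card : ℝ) ≤ (2 : ℝ) ^ (ddim * j)) ∧
      ∀ u, dist x u ≤ 2 ^ j * r → ∃ y ∈ T, dist y u ≤ r := by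
  classical
  induction j generalizing r with
  | zero => exact ⟨{x}, by simp, by simp⟩
  | succ j ih =>
    obtain ⟨T, hT, hcov⟩ := ih (r := 2 * r) (by positivity)
    choose S hS hScov using fun y : V => h y r hr
    refine ⟨T.biUnion S, ?_, fun u hu => ?_⟩
    · calc ((T.biUnion S).card : ℝ) ≤ ∑ y ∈ T, ((S y).card : ℝ) := by
            exact_mod_cast Finset.card_biUnion_le
        _ ≤ ∑ _y ∈ T, (2 : ℝ) ^ ddim := Finset.sum_le_sum fun y _ => hS y
        _ = T.card * (2 : ℝ) ^ ddim := by simp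
        _ ≤ (2 : ℝ) ^ (ddim * j) * (2 : ℝ) ^ ddim := by gcongr
        _ = (2 : ℝ) ^ (ddim * (j + 1 : ℕ)) := by
            rw [← Real.rpow_add two_pos]; push_cast; ring_nf
    · obtain ⟨y, hy, hyu⟩ := hcov u (by rw [pow_succ] at hu; linarith)
      obtain ⟨y', hy', hyu'⟩ := hScov y u hyu
      exact ⟨y', Finset.mem_biUnion.2 ⟨y, hy, hy'⟩, hyu'⟩

/-- A set of points at mutual distance more than `σ` has few points in a ball. -/
theorem IsDoubling.card_filter_le (h : IsDoubling V ddim) {N : Finset V} {σ : ℝ} (hσ : 0 < σ)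
    (hN : ∀ c ∈ N, ∀ c' ∈ N, c ≠ c' → σ < dist c c') (j : ℕ) (x : V) {R : ℝ}
    (hR : R ≤ 2 ^ j * (σ / 2)) [DecidablePred fun c => dist x c ≤ R] :
    ((N.filter fun c => dist x c ≤ R).card : ℝ) ≤ (2 : ℝ) ^ (ddim * j) := by
  obtain ⟨T, hT, hcov⟩ := h.exists_cover j x (half_pos hσ)
  choose! g hgT hg using hcov
  refine le_trans (Nat.cast_le.2 (Finset.card_le_card_of_injOn g ?_ ?_)) hT
  · intro c hc
    exact hgT c ((Finset.mem_filter.1 hc).2.trans hR)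
  · intro c hc c' hc' heq
    rw [Finset.mem_coe, Finset.mem_filter] at hc hc'
    by_contra hne
    have h1 := hg c (hc.2.trans hR)
    have h2 := hg c' (hc'.2.trans hR)
    rw [← heq] at h2
    linarith [hN c hc.1 c' hc'.1 hne, dist_triangle_left c c' (g c)]

theorem exists_net (V : Type*) [PseudoMetricSpace V] [Finite V] {σ : ℝ} (hσ : 0 ≤ σ) :
    ∃ N : Finset V, (∀ c ∈ N, ∀ c' ∈ N, c ≠ c' → σ < dist c c') ∧
      ∀ v, ∃ c ∈ N, dist v c ≤ σ := by
  classical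
  obtain ⟨N, -, hN⟩ := (Set.toFinite {N : Finset V | ∀ c ∈ N, ∀ c' ∈ N, c ≠ c' →
    σ < dist c c'}).exists_le_maximal (a := ∅) (by simp)
  refine ⟨N, hN.prop, fun v => ?_⟩
  by_contra! hv
  have hins : insert v N ∈ {N : Finset V | ∀ c ∈ N, ∀ c' ∈ N, c ≠ c' → σ < dist c c'} := by
    intro c hc c' hc' hne
    rcases Finset.mem_insert.1 hc with rfl | hcN <;>
      rcases Finset.mem_insert.1 hc' with rfl | hcN'
    · exact absurd rfl hne
    · exact hv c' hcN'
    · rw [dist_comm]; exact hv c hcN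
    · exact hN.prop c hcN c' hcN' hne
  have hvN : v ∈ N := hN.le_of_ge hins (Finset.subset_insert v N) (Finset.mem_insert_self v N)
  have := hv v hvN
  rw [dist_self] at this
  linarith

end Nets

section Shifts

open Real in
theorem local_lemma_estimate {ddim t : ℝ} (hd : 1 ≤ ddim) (ht : 2 ≤ t) {M n K j : ℕ}
    (hM : 50 * t ≤ M) (hM' : (M : ℝ) ≤ 51 * t)
    (hn : 60 * (2 : ℝ) ^ (ddim / t) * ddim * log t ≤ n)
    (hK : (K : ℝ) ≤ (2 : ℝ) ^ (ddim * 4)) (hj : (2 : ℝ) ^ j ≤ 64 * M)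
    {θ : ℝ} (hθ : θ = (2 : ℝ) ^ (-(10 * ddim / M))) :
    4 * ((1 - θ ^ 5 / 2) ^ n * (1 + θ ^ (M - 4)) ^ K) *
      ((2 : ℝ) ^ (ddim * j) * (2 * M + 1)) ≤ 1 := by
  have hM0 : (100 : ℝ) ≤ M := by linarith
  have hM4 : 4 ≤ M := by
    have : (4 : ℝ) ≤ M := by linarith
    exact_mod_cast this
  have ht0 : 0 < t := by linarith
  have hlog : 0 < log t := log_pos (by linarith)
  have hθ0 : 0 < θ := hθ ▸ rpow_pos_of_pos two_pos _
  have hθ1 : θ ≤ 1 := hθ ▸ rpow_le_one_of_one_le_of_nonpos one_le_two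
    (neg_nonpos.2 (by positivity))
  have hθ5 : (2 : ℝ) ^ (-(ddim / t)) ≤ θ ^ 5 := by
    rw [hθ, ← rpow_mul_natCast two_pos.le]
    refine rpow_le_rpow_of_exponent_le one_le_two ?_
    have : 10 * ddim / M * 5 ≤ ddim / t := by
      rw [div_mul_eq_mul_div, div_le_div_iff₀ (by linarith) ht0]
      nlinarith
    push_cast
    linarith
  have hθM : θ ^ (M - 4) ≤ (2 : ℝ) ^ (-(ddim * 5)) := by
    rw [hθ, ← rpow_mul_natCast two_pos.le]
    refine rpow_le_rpow_of_exponent_le one_le_two ?_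
    have : ddim * 5 ≤ 10 * ddim / M * ((M : ℝ) - 4) := by
      rw [div_mul_eq_mul_div, le_div_iff₀ (by linarith)]
      nlinarith
    push_cast [hM4]
    linarith
  have hfew : (1 + θ ^ (M - 4)) ^ K ≤ exp 1 := by
    calc (1 + θ ^ (M - 4)) ^ K ≤ exp (θ ^ (M - 4)) ^ K := by
          gcongr
          linarith [add_one_le_exp (θ ^ (M - 4))]
      _ = exp (K * θ ^ (M - 4)) := (exp_nat_mul _ _).symm
      _ ≤ exp 1 := by
          refine exp_le_exp.2 ?_
          calc (K : ℝ) * θ ^ (M - 4) ≤ (2 : ℝ) ^ (ddim * 4) * (2 : ℝ) ^ (-(ddim * 5)) := by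
                gcongr
            _ = (2 : ℝ) ^ (-ddim) := by rw [← rpow_add two_pos]; ring_nf
            _ ≤ 1 := rpow_le_one_of_one_le_of_nonpos one_le_two (by linarith)
  have hmany : (1 - θ ^ 5 / 2) ^ n ≤ t ^ (-(30 * ddim)) := by
    have hθ5' : θ ^ 5 ≤ 1 := pow_le_one₀ hθ0.le hθ1
    calc (1 - θ ^ 5 / 2) ^ n ≤ exp (-(θ ^ 5 / 2)) ^ n := by
          gcongr
          · linarith
          · linarith [add_one_le_exp (-(θ ^ 5 / 2))]
      _ = exp (n * -(θ ^ 5 / 2)) := (exp_nat_mul _ _).symm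
      _ ≤ exp (log t * (-(30 * ddim))) := by
          refine exp_le_exp.2 ?_
          have h1 : (2 : ℝ) ^ (ddim / t) * (2 : ℝ) ^ (-(ddim / t)) = 1 := by
            rw [← rpow_add two_pos]; simp
          have h2 : 60 * (2 : ℝ) ^ (ddim / t) * ddim * log t * (2 : ℝ) ^ (-(ddim / t)) ≤
              n * θ ^ 5 := by gcongr
          have h3 : 60 * (2 : ℝ) ^ (ddim / t) * ddim * log t * (2 : ℝ) ^ (-(ddim / t)) =
              60 * ddim * log t := by
            linear_combination 60 * ddim * log t * h1
          linarith
      _ = t ^ (-(30 * ddim)) := (rpow_def_of_pos ht0 _).symm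
  have hdeg : (2 : ℝ) ^ (ddim * j) * (2 * M + 1) ≤ t ^ (26 * ddim) := by
    have h64 : (64 * M : ℝ) ≤ t ^ 13 := by
      have : (2 : ℝ) ^ 12 ≤ t ^ 12 := by gcongr
      nlinarith
    calc (2 : ℝ) ^ (ddim * j) * (2 * M + 1) ≤ (64 * M : ℝ) ^ ddim * (64 * M : ℝ) ^ ddim := by
          gcongr
          · rw [mul_comm, rpow_mul two_pos.le, rpow_natCast]
            gcongr
          · calc (2 * M + 1 : ℝ) ≤ (64 * M : ℝ) ^ (1 : ℝ) := by rw [rpow_one]; linarith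
              _ ≤ (64 * M : ℝ) ^ ddim := rpow_le_rpow_of_exponent_le (by linarith) hd
      _ ≤ (t ^ 13) ^ ddim * (t ^ 13) ^ ddim := by gcongr
      _ = t ^ (26 * ddim) := by
          rw [← rpow_natCast, ← rpow_mul ht0.le, ← rpow_add ht0]
          push_cast
          ring_nf
  have hconst : 4 * exp 1 ≤ t ^ (4 * ddim) := by
    calc 4 * exp 1 ≤ 2 ^ 4 := by linarith [exp_one_lt_three]
      _ ≤ t ^ 4 := by gcongr
      _ = t ^ (4 : ℝ) := by norm_cast
      _ ≤ t ^ (4 * ddim) := rpow_le_rpow_of_exponent_le (by linarith) (by linarith)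
  calc 4 * ((1 - θ ^ 5 / 2) ^ n * (1 + θ ^ (M - 4)) ^ K) *
        ((2 : ℝ) ^ (ddim * j) * (2 * M + 1))
      ≤ 4 * (t ^ (-(30 * ddim)) * exp 1) * t ^ (26 * ddim) := by gcongr
    _ = (4 * exp 1) * t ^ (-(30 * ddim)) * t ^ (26 * ddim) := by ring
    _ ≤ t ^ (4 * ddim) * t ^ (-(30 * ddim)) * t ^ (26 * ddim) := by gcongr
    _ = 1 := by
        rw [← rpow_add ht0, ← rpow_add ht0]
        ring_nf
        simp

/-- There are a net of centres and shifts in `[0, r]` such that few centres nearly minimise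
the shifted distance to any given point. -/
theorem IsDoubling.exists_shifts {V : Type*} [PseudoMetricSpace V] [Fintype V] {ddim t r : ℝ}
    (h : IsDoubling V ddim) (hd : 1 ≤ ddim) (ht : 2 ≤ t) (hr : 0 < r) :
    ∃ (N : Finset V) (δ : V → ℝ) (ρ : ℝ), r / (51 * t) ≤ ρ ∧ ρ ≤ r ∧
      (∀ v, ∃ c ∈ N, dist v c ≤ r) ∧ (∀ c, 0 ≤ δ c ∧ δ c ≤ r) ∧
      ∀ v, ({c ∈ (N : Set V) | ∀ c' ∈ N,
        dist v c - δ c ≤ dist v c' - δ c' + 2 * ρ}.ncard : ℝ) ≤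
          60 * (2 : ℝ) ^ (ddim / t) * ddim * Real.log t := by
  classical
  set M : ℕ := ⌈50 * t⌉₊ with hMdef
  have hM : 50 * t ≤ M := Nat.le_ceil _
  have hM' : (M : ℝ) ≤ 51 * t := by
    have := Nat.ceil_lt_add_one (show 0 ≤ 50 * t by linarith)
    linarith
  have hM0 : (0 : ℝ) < M := by linarith
  have hM4 : 4 ≤ M := by
    have : (4 : ℝ) ≤ M := by linarith
    exact_mod_cast this
  set ρ : ℝ := r / M with hρdef
  have hρ : 0 < ρ := div_pos hr hM0
  have hρM : ρ * M = r := div_mul_cancel₀ r hM0.ne'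
  have hρr : ρ ≤ r := by nlinarith
  obtain ⟨N, hNsep, hNcov⟩ := exists_net V hr.le
  obtain ⟨F, hFsep, hFcov⟩ := exists_net V hρ.le
  set S : ℝ := 60 * (2 : ℝ) ^ (ddim / t) * ddim * Real.log t with hS
  have hS0 : 0 ≤ S := by
    have := Real.log_pos (show 1 < t by linarith)
    positivity
  set n : ℕ := ⌊S⌋₊ + 1 with hn
  have hnS : S ≤ n := by
    rw [hn]; push_cast; exact (Nat.lt_floor_add_one S).le
  set θ : ℝ := (2 : ℝ) ^ (-(10 * ddim / M)) with hθ
  have hθ0 : 0 < θ := Real.rpow_pos_of_pos two_pos _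
  have hθ1 : θ < 1 := Real.rpow_lt_one_of_one_lt_of_neg one_lt_two
    (neg_lt_zero.2 (by positivity))
  obtain ⟨μ, _, hμ⟩ := exists_truncated_geometric hθ0 hθ1 M
  obtain ⟨j₀, hj₀, hj₀'⟩ := exists_nat_pow_near (show (1 : ℝ) ≤ 32 * M by linarith) one_lt_two
  let j := j₀ + 1
  have hj : (2 : ℝ) ^ j ≤ 64 * M := by
    simp only [j, pow_succ]; linarith
  let L : V → Finset V := fun f => N.filter fun c => dist f c ≤ 8 * r
  let k : V → V → ℕ := fun f c => ⌊dist f c / ρ⌋₊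
  have hL : ∀ f, ((L f).card : ℝ) ≤ (2 : ℝ) ^ (ddim * 4) := fun f => by
    exact_mod_cast h.card_filter_le hr hNsep 4 f (by linarith)
  let I : Finset (V × ℤ) := F ×ˢ Finset.Icc (-(M : ℤ)) M
  let A : I → Set (V → Fin (M + 1)) := fun i => crowded M (L i.1.1) (k i.1.1) i.1.2 n
  let Γ : I → Finset I := fun i => Finset.univ.filter fun i' => ¬ Disjoint (L i.1.1) (L i'.1.1)
  obtain ⟨K, hKmax, hK⟩ : ∃ K : ℕ, (∀ f, (L f).card ≤ K) ∧ (K : ℝ) ≤ (2 : ℝ) ^ (ddim * 4) := by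
    refine ⟨⌊(2 : ℝ) ^ (ddim * 4)⌋₊, fun f => Nat.le_floor (hL f), Nat.floor_le (by positivity)⟩
  have hprob : ∀ i, (Measure.pi fun _ : V => μ).real (A i) ≤
      (1 - θ ^ 5 / 2) ^ n * (1 + θ ^ (M - 4)) ^ K := by
    intro i
    refine (measureReal_crowded_le hμ hθ0 hθ1 hM4 _ _ _ _).trans ?_
    have hθ5 : θ ^ 5 ≤ 1 := pow_le_one₀ hθ0.le hθ1.le
    have hθM : 0 < θ ^ (M - 4) := pow_pos hθ0 _
    refine mul_le_mul_of_nonneg_left (pow_le_pow_right₀ (by linarith) (hKmax _))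
      (pow_nonneg (by linarith) _)
  have hdeg : ∀ i, ((Γ i).card : ℝ) ≤ (2 : ℝ) ^ (ddim * j) * (2 * M + 1) := by
    intro i
    have hsub : (Γ i).card ≤ ((F.filter fun f => dist i.1.1 f ≤ 16 * r) ×ˢ
        Finset.Icc (-(M : ℤ)) M).card := by
      refine Finset.card_le_card_of_injOn Subtype.val ?_ Subtype.val_injective.injOn
      intro i' hi'
      have hi'I := Finset.mem_product.1 i'.2
      have hnd : ¬ Disjoint (L i.1.1) (L i'.1.1) := (Finset.mem_filter.1 hi').2
      obtain ⟨c, hc, hc'⟩ := Finset.not_disjoint_iff.1 hnd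
      have h1 := (Finset.mem_filter.1 hc).2
      have h2 := (Finset.mem_filter.1 hc').2
      refine Finset.mem_coe.2 (Finset.mem_product.2 ⟨Finset.mem_filter.2 ⟨hi'I.1, ?_⟩, hi'I.2⟩)
      linarith [dist_triangle_right i.1.1 i'.1.1 c]
    have hpack := h.card_filter_le hρ hFsep j i.1.1 (R := 16 * r) (by
      have : 32 * (M : ℝ) * ρ ≤ 2 ^ j * ρ := mul_le_mul_of_nonneg_right hj₀'.le hρ.le
      nlinarith)
    have hIcc : ((Finset.Icc (-(M : ℤ)) M).card : ℝ) = 2 * M + 1 := by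
      rw [Int.card_Icc]
      have : ((M : ℤ) + 1 - -(M : ℤ)).toNat = 2 * M + 1 := by omega
      rw [this]; push_cast; ring
    calc ((Γ i).card : ℝ) ≤ ((F.filter fun f => dist i.1.1 f ≤ 16 * r).card : ℝ) *
          (Finset.Icc (-(M : ℤ)) M).card := by
          rw [← Nat.cast_mul, ← Finset.card_product]
          exact_mod_cast hsub
      _ ≤ _ := by rw [hIcc]; gcongr
  have hD : 1 ≤ (2 : ℝ) ^ (ddim * j) * (2 * M + 1) := by
    have : 1 ≤ (2 : ℝ) ^ (ddim * j) := Real.one_le_rpow one_le_two (by positivity)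
    nlinarith
  have hind : ∀ i (S : Finset I), Disjoint S (Γ i) →
      (Measure.pi fun _ : V => μ).real (A i ∩ ⋂ j ∈ S, (A j)ᶜ) =
        (Measure.pi fun _ : V => μ).real (A i) *
          (Measure.pi fun _ : V => μ).real (⋂ j ∈ S, (A j)ᶜ) := by
    intro i S hSΓ
    refine measureReal_pi_inter_of_dependsOn μ (S := L i.1.1) (T := S.biUnion fun i' => L i'.1.1)
      ?_ (dependsOn_crowded _ _ _ _ _) ?_
    · rw [Finset.disjoint_biUnion_right]
      intro i' hi'
      by_contra hnd
      exact Finset.disjoint_left.1 hSΓ hi' (Finset.mem_filter.2 ⟨Finset.mem_univ _, hnd⟩)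
    · intro ω ω' hω
      simp only [Set.mem_iInter, Set.mem_compl_iff]
      refine propext (forall₂_congr fun i' hi' => not_congr (Eq.to_iff ?_))
      exact dependsOn_crowded M (L i'.1.1) (k i'.1.1) i'.1.2 n fun c hc =>
        hω c (Finset.mem_coe.2 (Finset.mem_biUnion.2 ⟨i', hi', hc⟩))
  have hpos := lovasz_local_lemma (Measure.pi fun _ : V => μ) A
    (fun i => (Set.toFinite _).measurableSet) Γ hprob hdeg hD
    (local_lemma_estimate hd ht hM hM' hnS hK hj hθ) hind Finset.univ
  obtain ⟨ω, hω⟩ : (⋂ i ∈ (Finset.univ : Finset I), (A i)ᶜ).Nonempty := by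
    by_contra hne
    rw [Set.not_nonempty_iff_eq_empty] at hne
    rw [hne] at hpos
    simp at hpos
  have hgood : ∀ f ∈ F, ∀ T : ℤ, -(M : ℤ) ≤ T → T ≤ M → ω ∉ crowded M (L f) (k f) T n := by
    intro f hf T h1 h2
    have hi : (f, T) ∈ I := Finset.mem_product.2 ⟨hf, Finset.mem_Icc.2 ⟨h1, h2⟩⟩
    simpa using (Set.mem_iInter₂.1 hω) ⟨(f, T), hi⟩ (Finset.mem_univ _)
  have hωM : ∀ c, ((ω c : ℕ) : ℝ) ≤ M := fun c => Nat.cast_le.2 (Nat.lt_succ_iff.1 (ω c).2)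
  have hδ : ∀ c, 0 ≤ ρ * (ω c : ℕ) ∧ ρ * (ω c : ℕ) ≤ r := fun c =>
    ⟨by positivity, by rw [← hρM]; exact mul_le_mul_of_nonneg_left (hωM c) hρ.le⟩
  refine ⟨N, fun c => ρ * (ω c : ℕ), ρ, ?_, hρr, hNcov, hδ, fun v => ?_⟩
  · exact div_le_div_of_nonneg_left hr.le hM0 hM'
  obtain ⟨f, hfF, hvf⟩ := hFcov v
  obtain ⟨c₀, hc₀N, hc₀⟩ := hNcov f
  have hc₀L : c₀ ∈ L f := Finset.mem_filter.2 ⟨hc₀N, by linarith⟩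
  obtain ⟨c₁, hc₁L, hmax⟩ := (L f).exists_max_image (fun c => ((ω c : ℕ) : ℤ) - k f c) ⟨c₀, hc₀L⟩
  have hk : ∀ c, (k f c : ℝ) * ρ ≤ dist f c ∧ dist f c < (k f c + 1) * ρ := fun c =>
    ⟨(le_div_iff₀ hρ).1 (Nat.floor_le (div_nonneg dist_nonneg hρ.le)),
      (div_lt_iff₀ hρ).1 (Nat.lt_floor_add_one _)⟩
  have hk₀ : k f c₀ ≤ M := by
    have h1 := (hk c₀).1
    have h2 : (k f c₀ : ℝ) * ρ ≤ M * ρ := by linarith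
    exact_mod_cast le_of_mul_le_mul_right h2 hρ
  have hbad := hgood f hfF (((ω c₁ : ℕ) : ℤ) - k f c₁)
    (by have := hmax c₀ hc₀L; omega) (by have := (ω c₁).2; omega)
  have hcount : ((L f).filter fun c => ((ω c₁ : ℕ) : ℤ) - k f c₁ - 4 ≤
      ((ω c : ℕ) : ℤ) - k f c).card < n := by
    by_contra hcon
    exact hbad ⟨hmax, not_lt.1 hcon⟩
  refine le_trans (Nat.cast_le.2 (le_trans ?_ (Nat.lt_succ_iff.1 hcount))) (Nat.floor_le hS0)
  rw [← Set.ncard_coe_finset]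
  refine Set.ncard_le_ncard ?_ (Finset.finite_toSet _)
  rintro c ⟨hcN, hc⟩
  have hvf' : dist f v ≤ ρ := by rwa [dist_comm]
  have hc₁ : c₁ ∈ N := (Finset.mem_filter.1 hc₁L).1
  refine Finset.mem_coe.2 (Finset.mem_filter.2 ⟨Finset.mem_filter.2 ⟨hcN, ?_⟩, ?_⟩)
  · have h1 := hc c₀ hc₀N
    linarith [dist_triangle f v c, dist_triangle v f c₀, (hδ c).2, (hδ c₀).1]
  · have h1 := hc c₁ hc₁
    have h2 : (k f c - (ω c : ℕ) : ℝ) * ρ < (k f c₁ - (ω c₁ : ℕ) + 5 : ℝ) * ρ := by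
      linarith [dist_triangle f v c, dist_triangle v f c₁, (hk c).1, (hk c₁).2]
    have h3 : (k f c - (ω c : ℕ) : ℝ) < k f c₁ - (ω c₁ : ℕ) + 5 := lt_of_mul_lt_mul_right h2 hρ.le
    have h4 : ((k f c : ℤ) - (ω c : ℕ) : ℤ) < k f c₁ - (ω c₁ : ℕ) + 5 := by exact_mod_cast h3
    omega

end Shifts

section WeightedGraph

namespace Pad

variable {V : Type*} {G : SimpleGraph V} {w : Sym2 V → ℝ}

theorem walkWeight_nonneg (hw : ∀ e, 0 ≤ w e) {u v : V} (p : G.Walk u v) :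
    0 ≤ walkWeight w p := by
  refine List.sum_nonneg fun x hx => ?_
  obtain ⟨d, -, rfl⟩ := List.mem_map.1 hx
  exact hw _

@[simp]
theorem walkWeight_append {u v x : V} (p : G.Walk u v) (q : G.Walk v x) :
    walkWeight w (p.append q) = walkWeight w p + walkWeight w q := by
  simp [walkWeight, SimpleGraph.Walk.darts_append]

@[simp]
theorem walkWeight_reverse {u v : V} (p : G.Walk u v) :
    walkWeight w p.reverse = walkWeight w p := by
  simp [walkWeight, SimpleGraph.Walk.darts_reverse, List.sum_reverse, Function.comp_def]

theorem walkWeight_bypass_le [DecidableEq V] (hw : ∀ e, 0 ≤ w e) {u v : V} (p : G.Walk u v) :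
    walkWeight w p.bypass ≤ walkWeight w p := by
  refine (p.darts_bypass_sublist_darts.map _).sum_le_sum fun x hx => ?_
  obtain ⟨d, -, rfl⟩ := List.mem_map.1 hx
  exact hw _

theorem walkWeightI_eq {C : Set V} {u v : C} (p : (G.induce C).Walk u v) :
    walkWeightI w p = walkWeight w (p.map (SimpleGraph.Embedding.induce C).toHom) := by
  induction p with
  | nil => rfl
  | cons h p ih =>
    simp only [walkWeightI, walkWeight, SimpleGraph.Walk.map_cons, SimpleGraph.Walk.darts_cons,
      List.map_cons, List.sum_cons] at ih ⊢
    rw [ih]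
    rfl

theorem wdist_le_walkWeight (hw : ∀ e, 0 ≤ w e) {u v : V} (p : G.Walk u v) :
    wdist w G u v ≤ walkWeight w p := by
  refine csInf_le ⟨0, ?_⟩ ⟨p, rfl⟩
  rintro x ⟨q, rfl⟩
  exact walkWeight_nonneg hw q

theorem exists_walkWeight_eq_wdist [Fintype V] (hG : G.Connected) (hw : ∀ e, 0 ≤ w e) (u v : V) :
    ∃ p : G.Walk u v, walkWeight w p = wdist w G u v := by
  classical
  have hfin : {p : G.Walk u v | p.IsPath ∧ p.length < Fintype.card V}.Finite := Set.toFinite _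
  obtain ⟨q⟩ := hG.preconnected u v
  obtain ⟨p, hp⟩ := hfin.exists_minimalFor (walkWeight w) _
    ⟨q.bypass, q.bypass_isPath, q.bypass_isPath.length_lt⟩
  refine ⟨p, le_antisymm (le_csInf ⟨_, q, rfl⟩ ?_) (wdist_le_walkWeight hw p)⟩
  rintro x ⟨q', rfl⟩
  refine le_trans ?_ (walkWeight_bypass_le hw q')
  rcases le_total (walkWeight w p) (walkWeight w q'.bypass) with h | h
  · exact h
  · exact hp.2 ⟨q'.bypass_isPath, q'.bypass_isPath.length_lt⟩ h

theorem wdist_nonneg (hw : ∀ e, 0 ≤ w e) (u v : V) : 0 ≤ wdist w G u v := by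
  refine Real.sInf_nonneg ?_
  rintro x ⟨q, rfl⟩
  exact walkWeight_nonneg hw q

theorem wdist_self (hw : ∀ e, 0 ≤ w e) (v : V) : wdist w G v v = 0 :=
  le_antisymm (by simpa [walkWeight] using
    wdist_le_walkWeight hw (SimpleGraph.Walk.nil : G.Walk v v)) (wdist_nonneg hw v v)

/-- The shortest-path pseudometric of a connected weighted graph. -/
noncomputable abbrev pseudoMetricSpace [Fintype V] (hG : G.Connected) (hw : ∀ e, 0 ≤ w e) :
    PseudoMetricSpace V where
  dist := wdist w G
  dist_self := wdist_self hw
  dist_comm := by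
    have key : ∀ u v, wdist w G u v ≤ wdist w G v u := by
      intro u v
      obtain ⟨p, hp⟩ := exists_walkWeight_eq_wdist hG hw v u
      rw [← hp, ← walkWeight_reverse]
      exact wdist_le_walkWeight hw _
    exact fun u v => (key u v).antisymm (key v u)
  dist_triangle := by
    intro u v x
    obtain ⟨p, hp⟩ := exists_walkWeight_eq_wdist hG hw u v
    obtain ⟨q, hq⟩ := exists_walkWeight_eq_wdist hG hw v x
    rw [← hp, ← hq, ← walkWeight_append]
    exact wdist_le_walkWeight hw _

theorem wdist_add_wdist_le (hw : ∀ e, 0 ≤ w e) {u v x : V} (p : G.Walk u v)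
    (hx : x ∈ p.support) : wdist w G u x + wdist w G x v ≤ walkWeight w p := by
  classical
  rw [← p.take_spec hx, walkWeight_append]
  exact add_le_add (wdist_le_walkWeight hw _) (wdist_le_walkWeight hw _)

/-- A set containing, with each vertex `v`, all vertices on a shortest path from `v` to `c`
has strong diameter at most twice its radius around `c`. -/
theorem stronglyBounded_of_star [Fintype V] (hG : G.Connected) (hw : ∀ e, 0 ≤ w e)
    {C : Set V} {c : V} {R : ℝ} (hR : ∀ v ∈ C, wdist w G v c ≤ R)
    (hstar : ∀ v ∈ C, ∀ x, wdist w G v x + wdist w G x c ≤ wdist w G v c → x ∈ C) :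
    StronglyBounded w G C (2 * R) := by
  have key : ∀ v : C, ∃ (hc : c ∈ C) (p : (G.induce C).Walk v ⟨c, hc⟩), walkWeightI w p ≤ R := by
    rintro ⟨v, hv⟩
    obtain ⟨p, hp⟩ := exists_walkWeight_eq_wdist hG hw v c
    have hsupp : ∀ x ∈ p.support, x ∈ C := fun x hx =>
      hstar v hv x (hp ▸ wdist_add_wdist_le hw p hx)
    refine ⟨hsupp c p.end_mem_support, p.induce C hsupp, ?_⟩
    rw [walkWeightI_eq]
    exact ((congrArg (walkWeight w) (p.map_induce hsupp)).trans hp).le.trans (hR v hv)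
  intro u v
  obtain ⟨hc, p, hp⟩ := key u
  obtain ⟨_, q, hq⟩ := key v
  refine ⟨p.append q.reverse, ?_⟩
  rw [walkWeightI_eq] at hp hq ⊢
  rw [SimpleGraph.Walk.map_append, ← SimpleGraph.Walk.reverse_map, walkWeight_append,
    walkWeight_reverse]
  linarith

end Pad

end WeightedGraph

/-- Graphs with doubling dimension `ddim` admit, for every `t ≥ 2`, a
`(c₁·t, c₂·2^{ddim/t}·ddim·log t)`-sparse cover scheme, for universal constants `c₁, c₂ > 0`. -/
theorem doubling_sparse_cover_scheme :
    ∃ c₁ c₂ : ℝ, 0 < c₁ ∧ 0 < c₂ ∧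
      ∀ (V : Type) [Fintype V], ∀ (G : SimpleGraph V), G.Connected →
      ∀ w : Sym2 V → ℝ, (∀ e, 0 ≤ w e) →
      ∀ ddim : ℝ, 1 ≤ ddim → Pad.Doubling w G ddim →
      ∀ t : ℝ, 2 ≤ t →
      ∀ Δ : ℝ, 0 < Δ →
      ∃ (m : ℕ) (C : Fin m → Set V),
        (∀ i, Pad.StronglyBounded w G (C i) Δ) ∧
        (∀ v : V, ∃ i, Pad.ball w G v (Δ / (c₁ * t)) ⊆ C i) ∧
        (∀ v : V, (({i | v ∈ C i} : Set (Fin m)).ncard : ℝ) ≤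
          c₂ * (2 : ℝ) ^ (ddim / t) * ddim * Real.log t) := by
  refine ⟨408, 60, by norm_num, by norm_num, ?_⟩
  intro V _ G hG w hw ddim hd hdoub t ht Δ hΔ
  classical
  let _ := Pad.pseudoMetricSpace hG hw
  have hdist : ∀ u v : V, Pad.wdist w G u v = dist u v := fun _ _ => rfl
  have hD : IsDoubling V ddim := by
    intro x r hr
    obtain ⟨T, hfin, hcard, hcov⟩ := hdoub x r hr
    refine ⟨hfin.toFinset, by rwa [← Set.ncard_eq_toFinset_card T hfin], fun u hu => ?_⟩
    obtain ⟨y, hy, hyu⟩ := Set.mem_iUnion₂.1 (hcov (show u ∈ Pad.ball w G x (2 * r) from hu))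
    exact ⟨y, hfin.mem_toFinset.2 hy, hyu⟩
  obtain ⟨N, δ, ρ, hρ, hρr, hcov, hδ, hcount⟩ := hD.exists_shifts hd ht (r := Δ / 8) (by linarith)
  have hρ' : Δ / (408 * t) ≤ ρ := by
    rwa [div_div, show (8 : ℝ) * (51 * t) = 408 * t by ring] at hρ
  let C : V → Set V := fun c =>
    {v | ∀ c' ∈ N, dist v c - δ c ≤ dist v c' - δ c' + 2 * ρ}
  let e := N.equivFin.symm
  refine ⟨N.card, fun i => C (e i), fun i => ?_, fun v => ?_, fun v => ?_⟩
  · have h := Pad.stronglyBounded_of_star hG hw (C := C (e i)) (c := e i) (R := Δ / 2) ?_ ?_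
    · rwa [mul_div_cancel₀ Δ two_ne_zero] at h
    · intro v hv
      obtain ⟨c, hcN, hc⟩ := hcov v
      rw [hdist]
      linarith [hv c hcN, (hδ c).1, (hδ (e i)).2]
    · intro v hv x hx c hcN
      rw [hdist, hdist, hdist] at hx
      linarith [hv c hcN, dist_triangle v x c]
  · obtain ⟨c₀, hc₀, -⟩ := hcov v
    obtain ⟨c, hcN, hc⟩ := N.exists_min_image (fun c => dist v c - δ c) ⟨c₀, hc₀⟩
    refine ⟨e.symm ⟨c, hcN⟩, fun u hu c' hc' => ?_⟩
    have hu' : dist v u ≤ ρ := le_trans hu hρ'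
    rw [e.apply_symm_apply]
    linarith [hc c' hc', dist_triangle_left u c v, dist_triangle v u c']
  · refine le_trans (Nat.cast_le.2 ?_) (hcount v)
    refine Set.ncard_le_ncard_of_injOn (fun i => (e i : V)) (fun i hi => ⟨(e i).2, hi⟩)
      (Subtype.val_injective.comp e.injective).injOn (Set.toFinite _)
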